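/- (Theorem 3.5, LRD of the MFPP) Fix λ > 0 and s > 0, and assume Var_N(s) > 0. Then lim_{t→∞} t^{α₂} Corr_N(s,t) = (λ U(s) + (λ² s^{2α₁}/C₁²) E²_{α₁−α₂, 2α₁+1}(−C₂ s^{α₁−α₂}/C₁)) / (√Var_N(s) · √((λ²/C₂²)(2/Γ(2α₂+1) − 1/Γ(α₂+1)²))). In particular, since 0 < α₂ < 1, the mixed fractional Poisson process has the long-range dependence property. -/

import Mathlib

open Real MeasureTheory Filter Topology

/-- Two-parameter Mittag-Leffler function `E_{a,b}(x)`. -/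
noncomputable def ML (a b x : ℝ) : ℝ :=
  ∑' k : ℕ, x ^ k / Real.Gamma ((k : ℝ) * a + b)

/-- Second-order (three-parameter, `γ = 2`) Mittag-Leffler function `E²_{a,b}(x)`. -/
noncomputable def ML2 (a b x : ℝ) : ℝ :=
  ∑' k : ℕ, ((k : ℝ) + 1) * x ^ k / Real.Gamma ((k : ℝ) * a + b)

/-- Renewal function `U(t)` of the inverse mixed stable subordinator. -/
noncomputable def Ufun (a1 a2 C1 C2 t : ℝ) : ℝ :=
  t ^ a1 / C1 * ML (a1 - a2) (a1 + 1) (-C2 * t ^ (a1 - a2) / C1)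

/-- Renewal density `u(t)` of the inverse mixed stable subordinator. -/
noncomputable def ufun (a1 a2 C1 C2 t : ℝ) : ℝ :=
  t ^ (a1 - 1) / C1 * ML (a1 - a2) a1 (-C2 * t ^ (a1 - a2) / C1)

/-- Covariance function of the inverse mixed stable subordinator. -/
noncomputable def CovY (a1 a2 C1 C2 s t : ℝ) : ℝ :=
  (∫ τ in (0:ℝ)..(min s t),
      (Ufun a1 a2 C1 C2 (s - τ) + Ufun a1 a2 C1 C2 (t - τ)) * ufun a1 a2 C1 C2 τ)
    - Ufun a1 a2 C1 C2 s * Ufun a1 a2 C1 C2 t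

/-- Variance function of the inverse mixed stable subordinator. -/
noncomputable def VarY (a1 a2 C1 C2 t : ℝ) : ℝ := CovY a1 a2 C1 C2 t t

/-- The integral `I(s,t) = ∫₀^s U(t-τ) u(τ) dτ`. -/
noncomputable def Ifun (a1 a2 C1 C2 s t : ℝ) : ℝ :=
  ∫ τ in (0:ℝ)..s, Ufun a1 a2 C1 C2 (t - τ) * ufun a1 a2 C1 C2 τ

/-- The constant `K(s)`. -/
noncomputable def Kfun (a1 a2 C1 C2 s : ℝ) : ℝ :=
  s ^ (a1 + 1) / (C1 * C2 * Real.Gamma a2) *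
    ∑' k : ℕ, ((k : ℝ) * (a1 - a2) + a1) * (-C2 * s ^ (a1 - a2) / C1) ^ k /
      Real.Gamma ((k : ℝ) * (a1 - a2) + a1 + 2)

/-- Covariance function of the mixed fractional Poisson process. -/
noncomputable def CovN (a1 a2 C1 C2 lam s t : ℝ) : ℝ :=
  lam * Ufun a1 a2 C1 C2 (min s t) + lam ^ 2 * CovY a1 a2 C1 C2 s t

/-- Variance function of the mixed fractional Poisson process. -/
noncomputable def VarN (a1 a2 C1 C2 lam t : ℝ) : ℝ :=
  lam * Ufun a1 a2 C1 C2 t + lam ^ 2 * VarY a1 a2 C1 C2 t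

/-- Correlation function of the inverse mixed stable subordinator. -/
noncomputable def CorrY (a1 a2 C1 C2 s t : ℝ) : ℝ :=
  CovY a1 a2 C1 C2 s t /
    (Real.sqrt (VarY a1 a2 C1 C2 s) * Real.sqrt (VarY a1 a2 C1 C2 t))

/-- Correlation function of the mixed fractional Poisson process. -/
noncomputable def CorrN (a1 a2 C1 C2 lam s t : ℝ) : ℝ :=
  CovN a1 a2 C1 C2 lam s t /
    (Real.sqrt (VarN a1 a2 C1 C2 lam s) * Real.sqrt (VarN a1 a2 C1 C2 lam t))

/-- Covariance function of the mixed fractional Poissonian noise. -/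
noncomputable def CovZ (a1 a2 C1 C2 lam δ s t : ℝ) : ℝ :=
  CovN a1 a2 C1 C2 lam (s + δ) (t + δ) + CovN a1 a2 C1 C2 lam s t
    - CovN a1 a2 C1 C2 lam (s + δ) t - CovN a1 a2 C1 C2 lam s (t + δ)

/-- Variance function of the mixed fractional Poissonian noise. -/
noncomputable def VarZ (a1 a2 C1 C2 lam δ t : ℝ) : ℝ := CovZ a1 a2 C1 C2 lam δ t t

/-- Correlation function of the mixed fractional Poissonian noise. -/
noncomputable def CorrZ (a1 a2 C1 C2 lam δ s t : ℝ) : ℝ :=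
  CovZ a1 a2 C1 C2 lam δ s t /
    (Real.sqrt (VarZ a1 a2 C1 C2 lam δ s) * Real.sqrt (VarZ a1 a2 C1 C2 lam δ t))

/-- Incomplete Beta function `B(a, b; x)`. -/
noncomputable def Binc (a b x : ℝ) : ℝ :=
  ∫ y in (0:ℝ)..x, y ^ (a - 1) * (1 - y) ^ (b - 1)

/-- The fractional integration kernel `t ^ (p - 1) / Γ(p)`. -/
noncomputable def powKernel (p t : ℝ) : ℝ := t ^ (p - 1) / Real.Gamma p

/-- The Mittag-Leffler kernel `t ^ (b - 1) E_{d,b}(-c t ^ d)`. -/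
noncomputable def mlKernel (d c b t : ℝ) : ℝ := t ^ (b - 1) * ML d b (-(c * t ^ d))

/-- The second-order Mittag-Leffler kernel `t ^ (b - 1) E²_{d,b}(-c t ^ d)`. -/
noncomputable def mlKernel2 (d c b t : ℝ) : ℝ := t ^ (b - 1) * ML2 d b (-(c * t ^ d))

theorem powKernel_pos {p t : ℝ} (hp : 0 < p) (ht : 0 < t) : 0 < powKernel p t :=
  div_pos (rpow_pos_of_pos ht _) (Real.Gamma_pos_of_pos hp)

theorem powKernel_nonneg {p t : ℝ} (hp : 0 < p) (ht : 0 ≤ t) : 0 ≤ powKernel p t :=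
  div_nonneg (rpow_nonneg ht _) (Real.Gamma_pos_of_pos hp).le

theorem powKernel_one (t : ℝ) : powKernel 1 t = 1 := by
  simp [powKernel]

theorem integral_powKernel_mul {p q t : ℝ} (hp : 0 < p) (hq : 0 < q) (ht : 0 < t) :
    ∫ τ in (0:ℝ)..t, powKernel p (t - τ) * powKernel q τ = powKernel (p + q) t := by
  have h := Complex.betaIntegral_scaled (q : ℂ) (p : ℂ) ht
  have hb : Complex.betaIntegral q p = ((ProbabilityTheory.beta q p : ℝ) : ℂ) := by
    rw [Complex.betaIntegral_eq_Gamma_mul_div _ _ (by simpa) (by simpa), ProbabilityTheory.beta]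
    simp_rw [← Complex.ofReal_add, Complex.Gamma_ofReal]
    norm_cast
  have h2 : ∫ x in (0:ℝ)..t, (x:ℂ) ^ ((q:ℂ) - 1) * ((t:ℂ) - x) ^ ((p:ℂ) - 1)
      = ((∫ x in (0:ℝ)..t, x ^ (q - 1) * (t - x) ^ (p - 1) : ℝ) : ℂ) := by
    rw [← intervalIntegral.integral_ofReal]
    refine intervalIntegral.integral_congr fun x hx => ?_
    rw [Set.uIcc_of_le ht.le] at hx
    have h1 : 0 ≤ t - x := by linarith [hx.2]
    push_cast [Complex.ofReal_cpow hx.1, Complex.ofReal_cpow h1]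
    rfl
  have h3 : ((t : ℂ) ^ ((q:ℂ) + p - 1)) = ((t ^ (q + p - 1) : ℝ) : ℂ) := by
    rw [Complex.ofReal_cpow ht.le]; push_cast; rfl
  rw [h2, hb, h3] at h
  have h4 : ∫ x in (0:ℝ)..t, x ^ (q - 1) * (t - x) ^ (p - 1)
      = t ^ (q + p - 1) * ProbabilityTheory.beta q p := by exact_mod_cast h
  have h5 : ∀ τ, powKernel p (t - τ) * powKernel q τ
      = (1 / (Real.Gamma p * Real.Gamma q)) * (τ ^ (q - 1) * (t - τ) ^ (p - 1)) := by
    intro τ; simp only [powKernel]; field_simp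
  simp_rw [h5]
  rw [intervalIntegral.integral_const_mul, h4, ProbabilityTheory.beta, powKernel, add_comm p q]
  have := (Real.Gamma_pos_of_pos hp).ne'
  have := (Real.Gamma_pos_of_pos hq).ne'
  field_simp

theorem intervalIntegrable_powKernel_mul {p q t : ℝ} (hp : 0 < p) (hq : 0 < q) (ht : 0 < t) :
    IntervalIntegrable (fun τ => powKernel p (t - τ) * powKernel q τ) volume 0 t := by
  by_contra h
  have h1 := integral_powKernel_mul hp hq ht
  rw [intervalIntegral.integral_undef h] at h1
  exact (powKernel_pos (add_pos hp hq) ht).ne h1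

theorem rpow_mul_exp_neg_le_Gamma {R y : ℝ} (hR : 0 ≤ R) (hy : 1 ≤ y) :
    R ^ (y - 1) * Real.exp (-R) ≤ Real.Gamma y := by
  have hy0 : 0 < y := by linarith
  rw [Real.Gamma_eq_integral hy0, ← integral_exp_neg_Ioi, ← integral_const_mul]
  have hi := Real.GammaIntegral_convergent hy0
  have hsub : Set.Ioi R ⊆ Set.Ioi (0:ℝ) := Set.Ioi_subset_Ioi hR
  calc ∫ x in Set.Ioi R, R ^ (y - 1) * Real.exp (-x)
      ≤ ∫ x in Set.Ioi R, Real.exp (-x) * x ^ (y - 1) := by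
        refine setIntegral_mono_on ((integrableOn_exp_neg_Ioi R).const_mul _)
          (hi.mono_set hsub) measurableSet_Ioi fun x hx => ?_
        rw [mul_comm]
        have : R ^ (y - 1) ≤ x ^ (y - 1) :=
          rpow_le_rpow hR (le_of_lt hx) (by linarith)
        gcongr
    _ ≤ _ := by
        refine setIntegral_mono_set hi ?_ hsub.eventuallyLE
        filter_upwards [ae_restrict_mem measurableSet_Ioi] with x hx
        have : (0:ℝ) < x := hx
        positivity

theorem summable_ML2_abs {d b : ℝ} (hd : 0 < d) (hb : 0 < b) (x : ℝ) :
    Summable fun k : ℕ => ((k : ℝ) + 1) * |x| ^ k / Real.Gamma ((k : ℝ) * d + b) := by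
  set M := 2 * (|x| + 1) with hM
  have hx0 := abs_nonneg x
  have hMp : 0 < M := by positivity
  set R := M ^ (1 / d) with hR
  have hRp : 0 < R := rpow_pos_of_pos hMp _
  have hRd : R ^ d = M := by
    rw [hR, ← rpow_mul hMp.le, one_div_mul_cancel hd.ne', rpow_one]
  have hs : Summable fun k : ℕ =>
      (Real.exp R * R ^ (1 - b)) * (((k : ℝ) ^ 1 * (1 / 2 : ℝ) ^ k) + (1 / 2 : ℝ) ^ k) := by
    refine Summable.mul_left _ (Summable.add ?_ ?_)
    · exact summable_pow_mul_geometric_of_norm_lt_one 1 (by norm_num)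
    · exact summable_geometric_of_lt_one (by norm_num) (by norm_num)
  refine Summable.of_norm_bounded_eventually_nat hs ?_
  filter_upwards [eventually_ge_atTop ⌈1 / d⌉₊] with k hk
  have hk1 : 1 / d ≤ k := (Nat.le_ceil _).trans (by exact_mod_cast hk)
  have hk2 : 1 ≤ (k : ℝ) * d := by rwa [div_le_iff₀ hd] at hk1
  have hG := rpow_mul_exp_neg_le_Gamma hRp.le (show 1 ≤ (k : ℝ) * d + b by linarith)
  have hGp : 0 < Real.Gamma ((k : ℝ) * d + b) := Real.Gamma_pos_of_pos (by linarith)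
  rw [Real.norm_of_nonneg (by positivity), div_le_iff₀ hGp]
  have e1 : R ^ ((k : ℝ) * d + b - 1) = M ^ k * (R ^ (1 - b))⁻¹ := by
    rw [← rpow_neg hRp.le, ← hRd, ← rpow_natCast, ← rpow_mul hRp.le, ← rpow_add hRp]
    congr 1; ring
  rw [e1, Real.exp_neg] at hG
  have hRb : 0 < R ^ (1 - b) := rpow_pos_of_pos hRp _
  have hE := Real.exp_pos R
  have h1 : |x| ^ k ≤ (1 / 2 : ℝ) ^ k * M ^ k := by
    rw [← mul_pow]
    exact pow_le_pow_left₀ hx0 (by rw [hM]; linarith) k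
  calc ((k : ℝ) + 1) * |x| ^ k ≤ ((k : ℝ) + 1) * ((1 / 2 : ℝ) ^ k * M ^ k) := by gcongr
    _ = Real.exp R * R ^ (1 - b) * ((k : ℝ) ^ 1 * (1 / 2 : ℝ) ^ k + (1 / 2 : ℝ) ^ k)
        * (M ^ k * (R ^ (1 - b))⁻¹ * (Real.exp R)⁻¹) := by field_simp
    _ ≤ _ := by gcongr

theorem summable_ML_abs {d b : ℝ} (hd : 0 < d) (hb : 0 < b) (x : ℝ) :
    Summable fun k : ℕ => |x| ^ k / Real.Gamma ((k : ℝ) * d + b) := by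
  refine Summable.of_nonneg_of_le (fun k => ?_) (fun k => ?_) (summable_ML2_abs hd hb x)
  · have : 0 < Real.Gamma ((k : ℝ) * d + b) := Real.Gamma_pos_of_pos (by positivity)
    positivity
  · have : 0 < Real.Gamma ((k : ℝ) * d + b) := Real.Gamma_pos_of_pos (by positivity)
    gcongr
    exact le_mul_of_one_le_left (by positivity) (by linarith [Nat.cast_nonneg (α := ℝ) k])

theorem continuous_ML {d b : ℝ} (hd : 0 < d) (hb : 0 < b) : Continuous (ML d b) := by
  rw [continuous_iff_continuousAt]
  intro x
  have : ContinuousOn (ML d b) (Set.Ioo (-(|x| + 1)) (|x| + 1)) := by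
    refine continuousOn_tsum (u := fun k : ℕ => |(|x| + 1)| ^ k / Real.Gamma ((k : ℝ) * d + b))
      (fun k => by fun_prop) (summable_ML_abs hd hb (|x| + 1)) fun k y hy => ?_
    have : 0 < Real.Gamma ((k : ℝ) * d + b) := Real.Gamma_pos_of_pos (by positivity)
    rw [norm_div, norm_pow, Real.norm_eq_abs, Real.norm_of_nonneg this.le]
    have h2 : |y| ≤ |(|x| + 1)| := (abs_lt.2 ⟨hy.1, hy.2⟩).le.trans (le_abs_self _)
    gcongr
  exact this.continuousAt (Ioo_mem_nhds (by linarith [neg_abs_le x]) (by linarith [le_abs_self x]))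

theorem integral_eq_tsum_of_nonneg_terms {t c : ℝ} (ht : 0 ≤ t) (hc : 0 ≤ c) {G : ℝ → ℝ}
    {h : ℕ → ℝ → ℝ} {H : ℕ → ℝ}
    (hint : ∀ k, IntervalIntegrable (h k) volume 0 t)
    (hH : ∀ k, ∫ τ in (0:ℝ)..t, h k τ = H k)
    (hnn : ∀ k, ∀ τ ∈ Set.Ioo 0 t, 0 ≤ h k τ)
    (hG : ∀ τ ∈ Set.Ioo 0 t, G τ = ∑' k : ℕ, (-c) ^ k * h k τ)
    (hs : Summable fun k => c ^ k * H k) :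
    ∫ τ in (0:ℝ)..t, G τ = ∑' k : ℕ, (-c) ^ k * H k := by
  have hH' : ∀ k, ∫ τ in Set.Ioo 0 t, h k τ = H k := fun k => by
    rw [← hH k, intervalIntegral.integral_of_le ht, integral_Ioc_eq_integral_Ioo]
  have hint' : ∀ k, IntegrableOn (h k) (Set.Ioo 0 t) := fun k =>
    ((intervalIntegrable_iff_integrableOn_Ioo_of_le ht).1 (hint k))
  rw [intervalIntegral.integral_of_le ht, integral_Ioc_eq_integral_Ioo,
    setIntegral_congr_fun measurableSet_Ioo hG,
    ← integral_tsum_of_summable_integral_norm (fun k => (hint' k).const_mul ((-c) ^ k))]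
  · simp_rw [integral_const_mul, hH']
  · convert hs using 2 with k
    rw [← hH' k, ← integral_const_mul]
    refine setIntegral_congr_fun measurableSet_Ioo fun τ hτ => ?_
    simp only [norm_mul, norm_pow, norm_neg, Real.norm_of_nonneg hc,
      Real.norm_of_nonneg (hnn k τ hτ)]

section Convolution

variable {d c t : ℝ}

theorem rpow_mul_ML_term {b : ℝ} (ht : 0 < t) (k : ℕ) :
    t ^ (b - 1) * ((-(c * t ^ d)) ^ k / Real.Gamma ((k : ℝ) * d + b))
      = (-c) ^ k * powKernel ((k : ℝ) * d + b) t := by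
  have : t ^ ((k : ℝ) * d + b - 1) = t ^ (b - 1) * (t ^ d) ^ k := by
    rw [← rpow_natCast, ← rpow_mul ht.le, ← rpow_add ht]
    congr 1; ring
  rw [powKernel, this, ← neg_mul, mul_pow]
  ring

theorem mlKernel_eq_tsum (b : ℝ) (ht : 0 < t) :
    mlKernel d c b t = ∑' k : ℕ, (-c) ^ k * powKernel ((k : ℝ) * d + b) t := by
  rw [mlKernel, ML, ← tsum_mul_left]
  exact tsum_congr fun k => rpow_mul_ML_term ht k

theorem mlKernel2_eq_tsum (b : ℝ) (ht : 0 < t) :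
    mlKernel2 d c b t
      = ∑' k : ℕ, (-c) ^ k * (((k : ℝ) + 1) * powKernel ((k : ℝ) * d + b) t) := by
  rw [mlKernel2, ML2, ← tsum_mul_left]
  refine tsum_congr fun k => ?_
  rw [mul_left_comm, ← rpow_mul_ML_term ht k]
  ring

theorem summable_mlKernel2 {b : ℝ} (hd : 0 < d) (hc : 0 ≤ c) (hb : 0 < b) (ht : 0 < t) :
    Summable fun k : ℕ => c ^ k * (((k : ℝ) + 1) * powKernel ((k : ℝ) * d + b) t) := by
  refine ((summable_ML2_abs hd hb (c * t ^ d)).mul_left (t ^ (b - 1))).congr fun k => ?_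
  have h := rpow_mul_ML_term (c := -c) (d := d) (b := b) ht k
  have hx : 0 ≤ c * t ^ d := mul_nonneg hc (rpow_nonneg ht.le _)
  simp only [neg_mul, neg_neg] at h
  rw [abs_of_nonneg hx, mul_left_comm (c ^ k), ← h]
  ring

theorem summable_mlKernel {b : ℝ} (hd : 0 < d) (hc : 0 ≤ c) (hb : 0 < b) (ht : 0 < t) :
    Summable fun k : ℕ => c ^ k * powKernel ((k : ℝ) * d + b) t := by
  have hp : ∀ k : ℕ, 0 ≤ powKernel ((k : ℝ) * d + b) t :=
    fun k => powKernel_nonneg (by positivity) ht.le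
  refine Summable.of_nonneg_of_le (fun k => mul_nonneg (pow_nonneg hc _) (hp k)) (fun k => ?_)
    (summable_mlKernel2 hd hc hb ht)
  refine mul_le_mul_of_nonneg_left ?_ (pow_nonneg hc _)
  exact le_mul_of_one_le_left (hp k) (by linarith [Nat.cast_nonneg (α := ℝ) k])

theorem integral_powKernel_mul_mlKernel {p q : ℝ} (hd : 0 < d) (hc : 0 ≤ c)
    (hp : 0 < p) (hq : 0 < q) (ht : 0 < t) :
    ∫ τ in (0:ℝ)..t, powKernel p (t - τ) * mlKernel d c q τ = mlKernel d c (p + q) t := by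
  have hq' : ∀ k : ℕ, 0 < (k : ℝ) * d + q := fun k => by positivity
  rw [mlKernel_eq_tsum _ ht]
  refine integral_eq_tsum_of_nonneg_terms ht.le hc
    (h := fun k τ => powKernel p (t - τ) * powKernel ((k : ℝ) * d + q) τ)
    (fun k => intervalIntegrable_powKernel_mul hp (hq' k) ht) (fun k => ?_)
    (fun k τ hτ => ?_) (fun τ hτ => ?_) (summable_mlKernel hd hc (by positivity) ht)
  · rw [integral_powKernel_mul hp (hq' k) ht]
    congr 1; ring
  · exact mul_nonneg (powKernel_nonneg hp (by linarith [hτ.2]))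
      (powKernel_nonneg (hq' k) hτ.1.le)
  · rw [mlKernel_eq_tsum _ hτ.1, ← tsum_mul_left]
    exact tsum_congr fun k => by ring

theorem integral_mlKernel_mul_mlKernel {p q : ℝ} (hd : 0 < d) (hc : 0 ≤ c)
    (hp : 0 < p) (hq : 0 < q) (ht : 0 < t) :
    ∫ τ in (0:ℝ)..t, mlKernel d c p (t - τ) * mlKernel d c q τ = mlKernel2 d c (p + q) t := by
  have hp' : ∀ k : ℕ, 0 < (k : ℝ) * d + p := fun k => by positivity
  have hq' : ∀ k : ℕ, 0 < (k : ℝ) * d + q := fun k => by positivity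
  have hsn : ∀ {b r : ℝ}, 0 < b → 0 < r →
      Summable fun k : ℕ => ‖(-c) ^ k * powKernel ((k : ℝ) * d + b) r‖ := fun {b r} hb hr => by
    refine (summable_mlKernel hd hc hb hr).congr fun k => ?_
    rw [norm_mul, norm_pow, norm_neg, Real.norm_of_nonneg hc,
      Real.norm_of_nonneg (powKernel_nonneg (by positivity) hr.le)]
  rw [mlKernel2_eq_tsum _ ht]
  refine integral_eq_tsum_of_nonneg_terms ht.le hc
    (h := fun n τ => ∑ kl ∈ Finset.HasAntidiagonal.antidiagonal n,
      powKernel ((kl.1 : ℝ) * d + p) (t - τ) * powKernel ((kl.2 : ℝ) * d + q) τ)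
    (fun n => ?_) (fun n => ?_)
    (fun n τ hτ => ?_) (fun τ hτ => ?_) (summable_mlKernel2 hd hc (by positivity) ht)
  · have h := IntervalIntegrable.sum (Finset.HasAntidiagonal.antidiagonal n)
      fun (kl : ℕ × ℕ) _ => intervalIntegrable_powKernel_mul (hp' kl.1) (hq' kl.2) ht
    rwa [Finset.sum_fn] at h
  · rw [intervalIntegral.integral_finsetSum fun kl _ =>
      intervalIntegrable_powKernel_mul (hp' kl.1) (hq' kl.2) ht]
    rw [Finset.sum_congr rfl (g := fun _ => powKernel ((n : ℝ) * d + (p + q)) t)]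
    · simp
    · intro kl hkl
      rw [integral_powKernel_mul (hp' _) (hq' _) ht, ← Finset.HasAntidiagonal.mem_antidiagonal.1 hkl]
      congr 1; push_cast; ring
  · exact Finset.sum_nonneg fun kl _ => mul_nonneg
      (powKernel_nonneg (hp' _) (by linarith [hτ.2])) (powKernel_nonneg (hq' _) hτ.1.le)
  · have hτ2 : 0 < t - τ := by linarith [hτ.2]
    rw [mlKernel_eq_tsum _ hτ.1, mlKernel_eq_tsum _ hτ2,
      tsum_mul_tsum_eq_tsum_sum_antidiagonal_of_summable_norm (hsn hp hτ2) (hsn hq hτ.1)]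
    refine tsum_congr fun n => ?_
    rw [Finset.mul_sum]
    refine Finset.sum_congr rfl fun kl hkl => ?_
    rw [← Finset.HasAntidiagonal.mem_antidiagonal.1 hkl, pow_add]
    ring

theorem continuousOn_mlKernel {b : ℝ} (hd : 0 < d) (hb : 0 < b) :
    ContinuousOn (mlKernel d c b) (Set.Ioi 0) := by
  refine ContinuousOn.mul (fun x hx => ?_) (((continuous_ML hd hb).comp ?_).continuousOn)
  · exact (continuousAt_rpow_const _ _ (Or.inl (ne_of_gt hx))).continuousWithinAt
  · exact (continuous_const.mul (continuous_rpow_const hd.le)).neg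

theorem mlKernel_eq_powKernel_mul {b : ℝ} (hb : 0 < b) (t : ℝ) :
    mlKernel d c b t = powKernel b t * (Real.Gamma b * ML d b (-(c * t ^ d))) := by
  have := (Real.Gamma_pos_of_pos hb).ne'
  rw [mlKernel, powKernel]
  field_simp

theorem intervalIntegrable_powKernel_mul_mlKernel {p q : ℝ} (hd : 0 < d)
    (hp : 0 < p) (hq : 0 < q) (ht : 0 < t) :
    IntervalIntegrable (fun τ => powKernel p (t - τ) * mlKernel d c q τ) volume 0 t := by
  simp_rw [mlKernel_eq_powKernel_mul hq, ← mul_assoc]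
  have := (continuous_ML hd hq).comp ((continuous_const.mul (continuous_rpow_const hd.le)).neg :
    Continuous fun t : ℝ => -(c * t ^ d))
  refine IntervalIntegrable.mul_continuousOn ?_ this.continuousOn
  exact (intervalIntegrable_powKernel_mul hp hq ht).mul_const _

theorem intervalIntegrable_mlKernel_mul_mlKernel {p q : ℝ} (hd : 0 < d)
    (hp : 0 < p) (hq : 0 < q) (ht : 0 < t) :
    IntervalIntegrable (fun τ => mlKernel d c p (t - τ) * mlKernel d c q τ) volume 0 t := by
  have h : ∀ τ, mlKernel d c p (t - τ) * mlKernel d c q τ = powKernel p (t - τ) * mlKernel d c q τ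
      * (Real.Gamma p * ML d p (-(c * (t - τ) ^ d))) := fun τ => by
    rw [mlKernel_eq_powKernel_mul hp]; ring
  simp_rw [h]
  have := (continuous_ML hd hp).comp ((continuous_const.mul ((continuous_rpow_const hd.le).comp
    (continuous_const.sub continuous_id))).neg : Continuous fun τ : ℝ => -(c * (t - τ) ^ d))
  exact (intervalIntegrable_powKernel_mul_mlKernel hd hp hq ht).mul_continuousOn
    (this.const_mul _).continuousOn

theorem intervalIntegrable_mlKernel {q : ℝ} (hd : 0 < d) (hq : 0 < q) (ht : 0 < t) :
    IntervalIntegrable (mlKernel d c q) volume 0 t := by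
  simpa only [powKernel_one, one_mul] using
    intervalIntegrable_powKernel_mul_mlKernel (c := c) hd one_pos hq ht

theorem integral_mlKernel {q : ℝ} (hd : 0 < d) (hc : 0 ≤ c) (hq : 0 < q) (ht : 0 < t) :
    ∫ τ in (0:ℝ)..t, mlKernel d c q τ = mlKernel d c (1 + q) t := by
  simpa only [powKernel_one, one_mul] using
    integral_powKernel_mul_mlKernel hd hc one_pos hq ht

theorem mul_mlKernel_add {b : ℝ} (hd : 0 < d) (hc : 0 ≤ c) (hb : 0 < b) (ht : 0 < t) :
    c * mlKernel d c (b + d) t = powKernel b t - mlKernel d c b t := by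
  have hs : Summable fun k : ℕ => (-c) ^ k * powKernel ((k : ℝ) * d + b) t := by
    refine Summable.of_norm_bounded (summable_mlKernel hd hc hb ht) fun k => ?_
    rw [norm_mul, norm_pow, norm_neg, Real.norm_of_nonneg hc,
      Real.norm_of_nonneg (powKernel_nonneg (by positivity) ht.le)]
  rw [mlKernel_eq_tsum b ht, hs.tsum_eq_zero_add, mlKernel_eq_tsum _ ht, ← tsum_mul_left]
  have : ∀ k : ℕ, (-c) ^ (k + 1) * powKernel (((k + 1 : ℕ) : ℝ) * d + b) t
      = -(c * ((-c) ^ k * powKernel ((k : ℝ) * d + (b + d)) t)) := fun k => by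
    rw [pow_succ, show ((k + 1 : ℕ) : ℝ) * d + b = (k : ℝ) * d + (b + d) by push_cast; ring]
    ring
  simp_rw [this, tsum_neg]
  simp

end Convolution

section Positivity

variable {d c t : ℝ}

theorem powKernel_le_of_le {p s t : ℝ} (hp : 0 < p) (hp1 : p ≤ 1) (hs : 0 < s) (hst : s ≤ t) :
    powKernel p t ≤ powKernel p s :=
  div_le_div_of_nonneg_right (rpow_le_rpow_of_nonpos hs hst (by linarith))
    (Real.Gamma_pos_of_pos hp).le

/-- Log-convexity of the kernel, in cross-multiplied form. -/
theorem powKernel_mul_powKernel_le {p t T τ : ℝ} (hp : 0 < p) (hp1 : p ≤ 1)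
    (hτ : 0 ≤ τ) (hτt : τ < t) (htT : t ≤ T) :
    powKernel p (T - τ) * powKernel p t ≤ powKernel p T * powKernel p (t - τ) := by
  have hG := Real.Gamma_pos_of_pos hp
  have h1 : 0 < T - τ := by linarith
  have h2 : 0 < t - τ := by linarith
  simp only [powKernel, div_mul_div_comm]
  refine div_le_div_of_nonneg_right ?_ (by positivity)
  rw [← mul_rpow h1.le (by linarith), ← mul_rpow (by linarith) h2.le]
  refine rpow_le_rpow_of_nonpos (mul_pos (by linarith) h2) ?_ (by linarith)
  nlinarith

theorem half_le_powKernel_ratio {p t T : ℝ} (hp : 0 < p) (hp1 : p ≤ 1)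
    (ht : 0 < t) (hT : T / 2 ≤ t) (htT : t ≤ T) :
    powKernel p t / 2 ≤ powKernel p T := by
  have hG := Real.Gamma_pos_of_pos hp
  rw [powKernel, powKernel, div_right_comm]
  refine div_le_div_of_nonneg_right ?_ hG.le
  have h2 : (2 * t) ^ (p - 1) ≤ T ^ (p - 1) :=
    rpow_le_rpow_of_nonpos (by linarith) (by linarith) (by linarith)
  rw [mul_rpow (by norm_num) ht.le] at h2
  have h3 : (2 : ℝ)⁻¹ ≤ 2 ^ (p - 1) := by
    rw [← rpow_neg_one]
    exact rpow_le_rpow_of_exponent_le (by norm_num) (by linarith)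
  have h4 : 0 < t ^ (p - 1) := rpow_pos_of_pos ht _
  nlinarith

theorem integral_powKernel_sub {p a b : ℝ} (hp : 0 < p) (hab : a ≤ b) :
    ∫ τ in a..b, powKernel p (b - τ) = powKernel (p + 1) (b - a) := by
  rw [intervalIntegral.integral_comp_sub_left (fun x => powKernel p x) b, sub_self]
  rcases hab.eq_or_lt with rfl | hab
  · simp [powKernel, hp.ne']
  · have h := integral_powKernel_mul one_pos hp (sub_pos.2 hab)
    simpa only [powKernel_one, one_mul, add_comm] using h

/-- The resolvent kernel `t ^ (d - 1) E_{d,d}(-c t ^ d)` is positive. -/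
theorem mlKernel_self_pos (hd : 0 < d) (hd1 : d ≤ 1) (hc : 0 < c) (ht : 0 < t) :
    0 < mlKernel d c d t := by
  by_contra hneg
  have hcont : Continuous fun r : ℝ => ML d d (-(c * r ^ d)) := (continuous_ML hd hd).comp
    ((continuous_const.mul (continuous_rpow_const hd.le)).neg)
  have hML : ∀ r, 0 < r → (0 < mlKernel d c d r ↔ 0 < ML d d (-(c * r ^ d))) := fun r hr =>
    mul_pos_iff_of_pos_left (rpow_pos_of_pos hr _)
  have hcpt : IsCompact (Set.Icc 0 t ∩ {r | ML d d (-(c * r ^ d)) ≤ 0}) :=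
    isCompact_Icc.inter_right (isClosed_le hcont continuous_const)
  obtain ⟨T, ⟨⟨hT0, hTt⟩, hTneg⟩, hTmin⟩ := hcpt.exists_isLeast
    ⟨t, ⟨ht.le, le_rfl⟩, by rw [hML t ht] at hneg; exact not_lt.1 hneg⟩
  simp only [Set.mem_ofPred_eq] at hTneg
  have hTpos : 0 < T := by
    rcases hT0.eq_or_lt with rfl | h
    · exfalso
      have h0 : ML d d 0 = 1 / Real.Gamma d := by
        rw [ML, tsum_eq_single 0 (by intro k hk; simp [hk])]
        simp
      rw [zero_rpow hd.ne', mul_zero, neg_zero, h0] at hTneg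
      exact absurd (one_div_pos.2 (Real.Gamma_pos_of_pos hd)) (not_lt.2 hTneg)
    · exact h
  have hfT : mlKernel d c d T ≤ 0 := not_lt.1 fun h => not_lt.2 hTneg ((hML T hTpos).1 h)
  have hpos : ∀ r, 0 < r → r < T → 0 < mlKernel d c d r := fun r hr hrT => by
    rw [hML r hr]
    by_contra h
    exact absurd (hTmin ⟨⟨hr.le, hrT.le.trans hTt⟩, not_lt.1 h⟩) (not_le.2 hrT)
  obtain ⟨t₀, ht₀, ht₀T, hsmall⟩ : ∃ t₀, T / 2 ≤ t₀ ∧ t₀ < T ∧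
      c * powKernel (d + 1) (T - t₀) < 1 / 2 := by
    have hlim : Tendsto (fun r => c * powKernel (d + 1) (T - r)) (𝓝[<] T) (𝓝 0) := by
      have : Continuous fun r => c * powKernel (d + 1) (T - r) := by
        simp only [powKernel, add_sub_cancel_right]
        exact continuous_const.mul (((continuous_rpow_const hd.le).comp
          (continuous_const.sub continuous_id)).div_const _)
      have h2 := (this.tendsto T).mono_left (nhdsWithin_le_nhds (s := Set.Iio T))
      simpa [powKernel, hd.ne'] using h2
    have h1 := hlim.eventually (gt_mem_nhds (show (0:ℝ) < 1 / 2 by norm_num))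
    have h2 : ∀ᶠ r in 𝓝[<] T, r ∈ Set.Ioo (T / 2) T :=
      Ioo_mem_nhdsLT (by linarith)
    obtain ⟨r, hr1, hr2⟩ := (h1.and h2).exists
    exact ⟨r, hr2.1.le, hr2.2, hr1⟩
  have ht₀0 : 0 < t₀ := by linarith
  obtain ⟨m, ⟨hm1, hm2⟩, hmax⟩ := isCompact_Icc.exists_isMaxOn (Set.nonempty_Icc.2 ht₀T.le)
    ((continuousOn_mlKernel (c := c) hd hd).mono
      (fun x hx => lt_of_lt_of_le ht₀0 hx.1 : Set.Icc t₀ T ⊆ Set.Ioi 0))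
  have hm0 : 0 < m := by linarith
  have hfm : 0 < mlKernel d c d m :=
    (hpos t₀ ht₀0 ht₀T).trans_le (hmax ⟨le_rfl, ht₀T.le⟩)
  have hmT : m < T := lt_of_le_of_ne hm2 fun h => by rw [h] at hfm; linarith
  have hRT := mul_mlKernel_add hd hc.le hd hTpos
  have hRm := mul_mlKernel_add hd hc.le hd hm0
  rw [← integral_powKernel_mul_mlKernel hd hc.le hd hd hTpos] at hRT
  rw [← integral_powKernel_mul_mlKernel hd hc.le hd hd hm0] at hRm
  have hIT := intervalIntegrable_powKernel_mul_mlKernel (c := c) hd hd hd hTpos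
  have hIm := intervalIntegrable_powKernel_mul_mlKernel (c := c) hd hd hd hm0
  have hI1 := hIT.mono_set (c := 0) (d := m)
    (by rw [Set.uIcc_of_le hm0.le, Set.uIcc_of_le hTpos.le]; exact Set.Icc_subset_Icc_right hm2)
  have hI2 := hIT.mono_set (c := m) (d := T)
    (by rw [Set.uIcc_of_le hm2, Set.uIcc_of_le hTpos.le]; exact Set.Icc_subset_Icc_left hm0.le)
  rw [← intervalIntegral.integral_add_adjacent_intervals hI1 hI2] at hRT
  have hA : (∫ τ in (0:ℝ)..m, powKernel d (T - τ) * mlKernel d c d τ) * powKernel d m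
      ≤ powKernel d T * ∫ τ in (0:ℝ)..m, powKernel d (m - τ) * mlKernel d c d τ := by
    rw [← intervalIntegral.integral_mul_const, ← intervalIntegral.integral_const_mul]
    refine intervalIntegral.integral_mono_on_of_le_Ioo hm0.le (hI1.mul_const _)
      (hIm.const_mul _) fun τ hτ => ?_
    have h1 := powKernel_mul_powKernel_le hd hd1 hτ.1.le hτ.2 hm2
    have h2 := hpos τ hτ.1 (hτ.2.trans hmT)
    nlinarith
  have hB : ∫ τ in m..T, powKernel d (T - τ) * mlKernel d c d τ
      ≤ powKernel (d + 1) (T - m) * mlKernel d c d m := by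
    rw [← integral_powKernel_sub hd hm2, ← intervalIntegral.integral_mul_const]
    refine intervalIntegral.integral_mono_on_of_le_Ioo hm2 hI2 ?_ fun τ hτ => ?_
    · have h := intervalIntegrable_powKernel_mul hd one_pos hTpos
      simp only [powKernel_one, mul_one] at h
      refine (h.mono_set ?_).mul_const _
      rw [Set.uIcc_of_le hm2, Set.uIcc_of_le hTpos.le]
      exact Set.Icc_subset_Icc_left hm0.le
    · exact mul_le_mul_of_nonneg_left (hmax ⟨hm1.trans hτ.1.le, hτ.2.le⟩)
        (powKernel_nonneg hd (by linarith [hτ.2]))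
  have hC : powKernel (d + 1) (T - m) ≤ powKernel (d + 1) (T - t₀) := by
    simp only [powKernel, add_sub_cancel_right]
    refine div_le_div_of_nonneg_right (rpow_le_rpow (by linarith) (by linarith) hd.le)
      (Real.Gamma_pos_of_pos (by linarith)).le
  have hD := half_le_powKernel_ratio hd hd1 hm0 (ht₀.trans hm1) hm2
  have hkm := powKernel_pos hd hm0
  generalize (∫ τ in (0:ℝ)..m, powKernel d (T - τ) * mlKernel d c d τ) = I1 at *
  generalize (∫ τ in (0:ℝ)..m, powKernel d (m - τ) * mlKernel d c d τ) = I0 at *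
  generalize (∫ τ in m..T, powKernel d (T - τ) * mlKernel d c d τ) = I2 at *
  have e1 : c * I2 < mlKernel d c d m / 2 := by
    calc c * I2 ≤ c * (powKernel (d + 1) (T - m) * mlKernel d c d m) := by gcongr
      _ ≤ c * powKernel (d + 1) (T - t₀) * mlKernel d c d m := by
        rw [← mul_assoc]; gcongr
      _ < 1 / 2 * mlKernel d c d m := by gcongr
      _ = _ := by ring
  have e2 : powKernel d T * powKernel d m ≤ c * I1 * powKernel d m + c * I2 * powKernel d m := by
    rw [← add_mul]; gcongr; linarith
  have e3 : c * I1 * powKernel d m ≤ powKernel d T * (powKernel d m - mlKernel d c d m) := by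
    rw [← hRm]; nlinarith
  have e4 : c * I2 * powKernel d m < mlKernel d c d m / 2 * powKernel d m := by gcongr
  nlinarith

theorem mlKernel_nonneg {b : ℝ} (hd : 0 < d) (hd1 : d ≤ 1) (hc : 0 < c) (hb : d ≤ b)
    (ht : 0 < t) : 0 ≤ mlKernel d c b t := by
  rcases hb.eq_or_lt with rfl | hb
  · exact (mlKernel_self_pos hd hd1 hc ht).le
  · have h := integral_powKernel_mul_mlKernel hd hc.le (sub_pos.2 hb) hd ht
    rw [sub_add_cancel] at h
    rw [← h, intervalIntegral.integral_of_le ht.le, integral_Ioc_eq_integral_Ioo]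
    exact setIntegral_nonneg measurableSet_Ioo fun τ hτ => mul_nonneg
      (powKernel_nonneg (sub_pos.2 hb) (by linarith [hτ.2]))
      (mlKernel_self_pos hd hd1 hc hτ.1).le

end Positivity

theorem Gamma_two_mul_add_one_lt {a : ℝ} (ha : 0 < a) (ha1 : a < 1) :
    Real.Gamma (2 * a + 1) < 2 * Real.Gamma (a + 1) ^ 2 := by
  have h1 := integral_powKernel_mul ha ha one_pos
  have h2 := integral_powKernel_mul one_pos ha one_pos
  have i1 := intervalIntegrable_powKernel_mul ha ha one_pos
  have i2 := intervalIntegrable_powKernel_mul one_pos ha one_pos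
  have hG := Real.Gamma_pos_of_pos ha
  have hG2 := Real.Gamma_pos_of_pos (show 0 < 2 * a by linarith)
  have hpos := intervalIntegral.intervalIntegral_pos_of_pos_on
    (i1.sub (i2.const_mul (powKernel a 1))) (fun τ hτ => ?_) one_pos
  · rw [intervalIntegral.integral_sub i1 (i2.const_mul _), intervalIntegral.integral_const_mul,
      h1, h2] at hpos
    simp only [powKernel, one_rpow] at hpos
    rw [← two_mul, add_comm 1 a, Real.Gamma_add_one ha.ne', sub_pos, div_mul_div_comm, one_mul,
      one_div_lt_one_div (by positivity) hG2] at hpos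
    rw [Real.Gamma_add_one (by linarith), Real.Gamma_add_one ha.ne']
    nlinarith
  · have h3 : powKernel a 1 < powKernel a (1 - τ) :=
      div_lt_div_of_pos_right
        (rpow_lt_rpow_of_neg (by linarith [hτ.2]) (by linarith [hτ.1]) (by linarith)) hG
    have h4 := powKernel_pos ha hτ.1
    simp only [powKernel_one, one_mul, sub_pos]
    gcongr

section Asymptotics

variable {d c : ℝ}

theorem mlKernel_le_powKernel {b t : ℝ} (hd : 0 < d) (hd1 : d ≤ 1) (hc : 0 < c) (hb : d ≤ b)
    (ht : 0 < t) : mlKernel d c b t ≤ powKernel b t := by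
  have h := mul_mlKernel_add hd hc.le (hd.trans_le hb) ht
  have h2 := mlKernel_nonneg hd hd1 hc (show d ≤ b + d by linarith) ht
  nlinarith

theorem mul_mlKernel_add_le {b t : ℝ} (hd : 0 < d) (hd1 : d ≤ 1) (hc : 0 < c) (hb : d ≤ b)
    (ht : 0 < t) : c * mlKernel d c (b + d) t ≤ powKernel b t := by
  have h := mul_mlKernel_add hd hc.le (hd.trans_le hb) ht
  linarith [mlKernel_nonneg hd hd1 hc hb ht]

theorem mlKernel_one_antitoneOn (hd : 0 < d) (hd1 : d ≤ 1) (hc : 0 < c) :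
    AntitoneOn (mlKernel d c 1) (Set.Ioi 0) := by
  intro s hs t ht hst
  rw [Set.mem_Ioi] at hs ht
  have h1 := mul_mlKernel_add hd hc.le one_pos hs
  have h2 := mul_mlKernel_add hd hc.le one_pos ht
  rw [powKernel_one, ← integral_mlKernel hd hc.le hd hs] at h1
  rw [powKernel_one, ← integral_mlKernel hd hc.le hd ht] at h2
  have h3 : ∫ τ in (0:ℝ)..s, mlKernel d c d τ ≤ ∫ τ in (0:ℝ)..t, mlKernel d c d τ := by
    refine intervalIntegral.integral_mono_interval le_rfl hs.le hst ?_
      (intervalIntegrable_mlKernel hd hd ht)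
    filter_upwards [ae_restrict_mem measurableSet_Ioc] with τ hτ
    exact (mlKernel_self_pos hd hd1 hc hτ.1).le
  nlinarith

theorem exists_mlKernel_one_le (hd : 0 < d) (hd1 : d < 1) (hc : 0 < c) :
    ∃ C, 0 ≤ C ∧ ∀ t, 0 < t → mlKernel d c 1 t ≤ C * powKernel (1 - d) t := by
  have h1d : 0 < 1 - d := by linarith
  refine ⟨1 / (c * (1 - d)), by positivity, fun t ht => ?_⟩
  have h1 : t * mlKernel d c 1 t ≤ mlKernel d c (1 + 1) t := by
    rw [← integral_mlKernel hd hc.le one_pos ht]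
    calc t * mlKernel d c 1 t = ∫ _ in (0:ℝ)..t, mlKernel d c 1 t := by simp
      _ ≤ _ := by
        refine intervalIntegral.integral_mono_on_of_le_Ioo ht.le (by simp)
          (intervalIntegrable_mlKernel hd one_pos ht) fun τ hτ => ?_
        exact mlKernel_one_antitoneOn hd hd1.le hc hτ.1 (Set.mem_Ioi.2 ht) hτ.2.le
  have h2 := mul_mlKernel_add_le hd hd1.le hc (show d ≤ 1 + (1 - d) by linarith) ht
  rw [show 1 + (1 - d) + d = 1 + 1 by ring] at h2
  have h3 : powKernel (1 + (1 - d)) t = t * powKernel (1 - d) t / (1 - d) := by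
    rw [powKernel, powKernel, add_comm 1 (1 - d), Real.Gamma_add_one h1d.ne',
      show 1 - d + 1 - 1 = 1 + (1 - d - 1) by ring, rpow_add ht, rpow_one]
    field_simp
  rw [h3] at h2
  have h4 : c * (t * mlKernel d c 1 t) ≤ t * powKernel (1 - d) t / (1 - d) :=
    (mul_le_mul_of_nonneg_left h1 hc.le).trans h2
  rw [le_div_iff₀ h1d] at h4
  rw [one_div_mul_eq_div, le_div_iff₀ (by positivity)]
  have h5 : t * (mlKernel d c 1 t * (c * (1 - d))) ≤ t * powKernel (1 - d) t := by linarith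
  exact le_of_mul_le_mul_left h5 ht

theorem exists_mlKernel_le {b : ℝ} (hd : 0 < d) (hd1 : d < 1) (hc : 0 < c) (hb : 1 ≤ b) :
    ∃ C, 0 ≤ C ∧ ∀ t, 0 < t → mlKernel d c b t ≤ C * powKernel (b - d) t := by
  obtain ⟨C, hC, h⟩ := exists_mlKernel_one_le hd hd1 hc
  refine ⟨C, hC, fun t ht => ?_⟩
  rcases hb.eq_or_lt with rfl | hb
  · exact h t ht
  have hb0 : 0 < b - 1 := by linarith
  have h1d : 0 < 1 - d := by linarith
  have e1 := integral_powKernel_mul_mlKernel hd hc.le hb0 one_pos ht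
  have e2 := integral_powKernel_mul hb0 h1d ht
  rw [sub_add_cancel] at e1
  rw [show b - 1 + (1 - d) = b - d by ring] at e2
  rw [← e1, ← e2, ← intervalIntegral.integral_const_mul]
  refine intervalIntegral.integral_mono_on_of_le_Ioo ht.le
    (intervalIntegrable_powKernel_mul_mlKernel hd hb0 one_pos ht)
    ((intervalIntegrable_powKernel_mul hb0 h1d ht).const_mul _) fun τ hτ => ?_
  rw [mul_left_comm]
  exact mul_le_mul_of_nonneg_left (h τ hτ.1) (powKernel_nonneg hb0 (by linarith [hτ.2]))

theorem tendsto_rpow_mul_of_le_powKernel {b C : ℝ} {f : ℝ → ℝ} (hd : 0 < d)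
    (h0 : ∀ t, 0 < t → 0 ≤ f t) (h : ∀ t, 0 < t → f t ≤ C * powKernel (b - d) t) :
    Tendsto (fun t => t ^ (1 - b) * f t) atTop (𝓝 0) := by
  have hlim : Tendsto (fun t : ℝ => C / Real.Gamma (b - d) * t ^ (-d)) atTop (𝓝 0) := by
    simpa using (tendsto_rpow_neg_atTop hd).const_mul (C / Real.Gamma (b - d))
  refine squeeze_zero' ?_ ?_ hlim
  · filter_upwards [eventually_gt_atTop 0] with t ht
    exact mul_nonneg (rpow_nonneg ht.le _) (h0 t ht)
  · filter_upwards [eventually_gt_atTop 0] with t ht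
    refine (mul_le_mul_of_nonneg_left (h t ht) (rpow_nonneg ht.le _)).trans_eq ?_
    rw [powKernel, show -d = (1 - b) + (b - d - 1) by ring, rpow_add ht]
    ring

theorem rpow_mul_powKernel {b t : ℝ} (ht : 0 < t) :
    t ^ (1 - b) * powKernel b t = 1 / Real.Gamma b := by
  rw [powKernel, ← mul_div_assoc, ← rpow_add ht]
  simp

theorem tendsto_rpow_mul_mlKernel {b : ℝ} (hd : 0 < d) (hd1 : d < 1) (hc : 0 < c) (hb : 1 ≤ b) :
    Tendsto (fun t => t ^ (1 - b) * (c * mlKernel d c (b + d) t)) atTop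
      (𝓝 (1 / Real.Gamma b)) := by
  obtain ⟨C, -, h⟩ := exists_mlKernel_le hd hd1 hc hb
  have h1 := tendsto_rpow_mul_of_le_powKernel hd
    (fun t ht => mlKernel_nonneg hd hd1.le hc (hd1.le.trans hb) ht) h
  have h2 := h1.const_sub (1 / Real.Gamma b)
  rw [sub_zero] at h2
  refine h2.congr' ?_
  filter_upwards [eventually_gt_atTop 0] with t ht
  rw [mul_mlKernel_add hd hc.le (by linarith) ht, mul_sub, rpow_mul_powKernel ht]

theorem mul_mlKernel2_add {b q t : ℝ} (hd : 0 < d) (hc : 0 ≤ c) (hb : 0 < b) (hq : 0 < q)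
    (ht : 0 < t) :
    c * mlKernel2 d c (b + d + q) t = mlKernel d c (b + q) t - mlKernel2 d c (b + q) t := by
  rw [← integral_mlKernel_mul_mlKernel hd hc (by linarith) hq ht,
    ← integral_mlKernel_mul_mlKernel hd hc hb hq ht,
    ← integral_powKernel_mul_mlKernel hd hc hb hq ht,
    ← intervalIntegral.integral_sub (intervalIntegrable_powKernel_mul_mlKernel hd hb hq ht)
      (intervalIntegrable_mlKernel_mul_mlKernel hd hb hq ht),
    ← intervalIntegral.integral_const_mul, intervalIntegral.integral_of_le ht.le,
    intervalIntegral.integral_of_le ht.le, integral_Ioc_eq_integral_Ioo,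
    integral_Ioc_eq_integral_Ioo]
  refine setIntegral_congr_fun measurableSet_Ioo fun τ hτ => ?_
  have h := mul_mlKernel_add hd hc hb (sub_pos.2 hτ.2)
  rw [← mul_assoc, h, sub_mul]

theorem mlKernel2_nonneg {b q t : ℝ} (hd : 0 < d) (hd1 : d ≤ 1) (hc : 0 < c) (hb : d ≤ b)
    (hq : d ≤ q) (ht : 0 < t) : 0 ≤ mlKernel2 d c (b + q) t := by
  rw [← integral_mlKernel_mul_mlKernel hd hc.le (by linarith) (by linarith) ht,
    intervalIntegral.integral_of_le ht.le, integral_Ioc_eq_integral_Ioo]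
  exact setIntegral_nonneg measurableSet_Ioo fun τ hτ => mul_nonneg
    (mlKernel_nonneg hd hd1 hc hb (sub_pos.2 hτ.2)) (mlKernel_nonneg hd hd1 hc hq hτ.1)

theorem exists_mlKernel2_le {b q : ℝ} (hd : 0 < d) (hd1 : d < 1) (hc : 0 < c) (hb : 1 ≤ b)
    (hq : d ≤ q) :
    ∃ C, ∀ t, 0 < t → mlKernel2 d c (b + q) t ≤ C * powKernel (b + q - d - d) t := by
  obtain ⟨C, hC, h⟩ := exists_mlKernel_le hd hd1 hc hb
  obtain ⟨C', -, h'⟩ := exists_mlKernel_le hd hd1 hc (show 1 ≤ b + q - d by linarith)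
  refine ⟨C * C', fun t ht => ?_⟩
  have hbd : 0 < b - d := by linarith
  have hq0 : 0 < q := by linarith
  have hb0 : 0 < b := by linarith
  calc mlKernel2 d c (b + q) t ≤ C * mlKernel d c (b + q - d) t := by
        rw [show b + q - d = b - d + q by ring,
          ← integral_powKernel_mul_mlKernel hd hc.le hbd hq0 ht,
          ← integral_mlKernel_mul_mlKernel hd hc.le hb0 hq0 ht,
          ← intervalIntegral.integral_const_mul]
        refine intervalIntegral.integral_mono_on_of_le_Ioo ht.le
          (intervalIntegrable_mlKernel_mul_mlKernel hd hb0 hq0 ht)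
          ((intervalIntegrable_powKernel_mul_mlKernel hd hbd hq0 ht).const_mul _) fun τ hτ => ?_
        rw [← mul_assoc]
        exact mul_le_mul_of_nonneg_right (h _ (sub_pos.2 hτ.2))
          (mlKernel_nonneg hd hd1.le hc hq hτ.1)
    _ ≤ C * (C' * powKernel (b + q - d - d) t) := by gcongr; exact h' t ht
    _ = _ := by ring

theorem tendsto_rpow_mul_mlKernel2 {b q : ℝ} (hd : 0 < d) (hd1 : d < 1) (hc : 0 < c)
    (hb : 1 ≤ b) (hq : d ≤ q) :
    Tendsto (fun t => t ^ (1 - (b + q - d)) * (c ^ 2 * mlKernel2 d c (b + d + q) t)) atTop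
      (𝓝 (1 / Real.Gamma (b + q - d))) := by
  obtain ⟨C, h⟩ := exists_mlKernel2_le hd hd1 hc hb hq
  have h1 := tendsto_rpow_mul_of_le_powKernel hd
    (fun t ht => mlKernel2_nonneg hd hd1.le hc (by linarith) hq ht) h
  have h2 := (tendsto_rpow_mul_mlKernel hd hd1 hc (show 1 ≤ b + q - d by linarith)).sub
    (h1.const_mul c)
  rw [mul_zero, sub_zero, sub_add_cancel] at h2
  refine h2.congr' ?_
  filter_upwards [eventually_gt_atTop 0] with t ht
  rw [pow_two, mul_assoc, mul_mlKernel2_add hd hc.le (by linarith) (by linarith) ht]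
  ring

theorem abs_mlKernel_sub_le {q s t τ : ℝ} (hd : 0 < d) (hd1 : d ≤ 1) (hc : 0 < c) (hq : d ≤ q)
    (hq1 : q ≤ 1) (hτ : 0 ≤ τ) (hτs : τ ≤ s) (hst : s < t) :
    |mlKernel d c (1 + q) (t - τ) - mlKernel d c (1 + q) t| ≤ s * powKernel q (t - s) := by
  have hq0 : 0 < q := by linarith
  have h1 : 0 < t - τ := by linarith
  have h2 : 0 < t := by linarith
  have i2 := intervalIntegrable_mlKernel (c := c) hd hq0 h2
  have i1 := intervalIntegrable_mlKernel (c := c) hd hq0 h1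
  rw [← integral_mlKernel hd hc.le hq0 h1, ← integral_mlKernel hd hc.le hq0 h2, abs_sub_comm,
    intervalIntegral.integral_interval_sub_left i2 i1]
  have hk := powKernel_nonneg hq0 (show 0 ≤ t - s by linarith)
  have h3 := intervalIntegral.norm_integral_le_of_norm_le_const (a := t - τ) (b := t)
    (f := mlKernel d c q) (C := powKernel q (t - s)) fun r hr => by
      rw [Set.uIoc_of_le (by linarith)] at hr
      have hr0 : 0 < r := h1.trans hr.1
      rw [Real.norm_of_nonneg (mlKernel_nonneg hd hd1 hc hq hr0)]
      exact (mlKernel_le_powKernel hd hd1 hc hq hr0).trans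
        (powKernel_le_of_le hq0 hq1 (by linarith) (by linarith [hr.1]))
  rw [Real.norm_eq_abs, sub_sub_cancel, abs_of_nonneg hτ] at h3
  nlinarith

theorem tendsto_integral_mlKernel_sub {q s : ℝ} (hd : 0 < d) (hd1 : d ≤ 1) (hc : 0 < c)
    (hq : d ≤ q) (hq1 : q < 1) (hs : 0 < s) :
    Tendsto (fun t => (∫ τ in (0:ℝ)..s, mlKernel d c (1 + q) (t - τ) * mlKernel d c q τ)
      - mlKernel d c (1 + q) s * mlKernel d c (1 + q) t) atTop (𝓝 0) := by
  have hq0 : 0 < q := by linarith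
  have iq := intervalIntegrable_mlKernel (c := c) hd hq0 hs
  have hlim : Tendsto (fun t => s * powKernel q (t - s) * mlKernel d c (1 + q) s)
      atTop (𝓝 0) := by
    have h1 : Tendsto (fun t : ℝ => (t - s) ^ (-(1 - q))) atTop (𝓝 0) :=
      (tendsto_rpow_neg_atTop (by linarith)).comp (tendsto_atTop_add_const_right _ (-s) tendsto_id)
    have h2 := ((h1.div_const (Real.Gamma q)).const_mul s).mul_const (mlKernel d c (1 + q) s)
    simpa [powKernel] using h2
  refine squeeze_zero_norm' ?_ hlim
  filter_upwards [eventually_gt_atTop s] with t hst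
  have ht : 0 < t := hs.trans hst
  have i1 := (intervalIntegrable_mlKernel_mul_mlKernel (c := c) hd (show 0 < 1 + q by linarith)
    hq0 ht).mono_set (c := 0) (d := s) (by
      rw [Set.uIcc_of_le hs.le, Set.uIcc_of_le ht.le]; exact Set.Icc_subset_Icc_right hst.le)
  rw [← integral_mlKernel hd hc.le hq0 hs, mul_comm (∫ τ in (0:ℝ)..s, mlKernel d c q τ) _,
    ← intervalIntegral.integral_const_mul, ← intervalIntegral.integral_const_mul,
    ← intervalIntegral.integral_sub i1 (iq.const_mul _)]
  refine intervalIntegral.norm_integral_le_of_norm_le hs.le ?_ (iq.const_mul _)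
  refine ae_of_all _ fun τ hτ => ?_
  rw [← sub_mul, norm_mul, Real.norm_eq_abs,
    Real.norm_of_nonneg (mlKernel_nonneg hd hd1 hc hq hτ.1)]
  exact mul_le_mul_of_nonneg_right
    (abs_mlKernel_sub_le hd hd1 hc hq hq1.le hτ.1.le hτ.2 hst)
    (mlKernel_nonneg hd hd1 hc hq hτ.1)

end Asymptotics

section Renewal

variable {a1 a2 C1 C2 : ℝ}

theorem Ufun_eq_mlKernel (t : ℝ) :
    Ufun a1 a2 C1 C2 t = mlKernel (a1 - a2) (C2 / C1) (1 + a1) t / C1 := by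
  rw [Ufun, mlKernel, add_sub_cancel_left, add_comm 1 a1,
    show -C2 * t ^ (a1 - a2) / C1 = -(C2 / C1 * t ^ (a1 - a2)) by ring]
  ring

theorem ufun_eq_mlKernel (t : ℝ) :
    ufun a1 a2 C1 C2 t = mlKernel (a1 - a2) (C2 / C1) a1 t / C1 := by
  rw [ufun, mlKernel, show -C2 * t ^ (a1 - a2) / C1 = -(C2 / C1 * t ^ (a1 - a2)) by ring]
  ring

theorem CovY_eq_mlKernel {s t : ℝ} (ha2 : 0 < a2) (ha12 : a2 < a1) (hC1 : 0 < C1) (hC2 : 0 < C2)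
    (hs : 0 < s) (hst : s ≤ t) :
    CovY a1 a2 C1 C2 s t
      = (mlKernel2 (a1 - a2) (C2 / C1) (1 + a1 + a1) s
        + ((∫ τ in (0:ℝ)..s, mlKernel (a1 - a2) (C2 / C1) (1 + a1) (t - τ)
              * mlKernel (a1 - a2) (C2 / C1) a1 τ)
          - mlKernel (a1 - a2) (C2 / C1) (1 + a1) s
            * mlKernel (a1 - a2) (C2 / C1) (1 + a1) t)) / C1 ^ 2 := by
  have hd : 0 < a1 - a2 := by linarith
  have h1 : 0 < a1 := by linarith
  have h2 : 0 < 1 + a1 := by linarith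
  have ht := hs.trans_le hst
  have i1 := intervalIntegrable_mlKernel_mul_mlKernel (c := C2 / C1) hd h2 h1 hs
  have i2 := (intervalIntegrable_mlKernel_mul_mlKernel (c := C2 / C1) hd h2 h1 ht).mono_set
    (c := 0) (d := s) (by
      rw [Set.uIcc_of_le hs.le, Set.uIcc_of_le ht.le]; exact Set.Icc_subset_Icc_right hst)
  have e : ∀ τ, (Ufun a1 a2 C1 C2 (s - τ) + Ufun a1 a2 C1 C2 (t - τ)) * ufun a1 a2 C1 C2 τ
      = (mlKernel (a1 - a2) (C2 / C1) (1 + a1) (s - τ) * mlKernel (a1 - a2) (C2 / C1) a1 τ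
        + mlKernel (a1 - a2) (C2 / C1) (1 + a1) (t - τ) * mlKernel (a1 - a2) (C2 / C1) a1 τ)
          / C1 ^ 2 := fun τ => by
    rw [Ufun_eq_mlKernel, Ufun_eq_mlKernel, ufun_eq_mlKernel]; field_simp
  rw [CovY, min_eq_left hst]
  simp_rw [e]
  rw [intervalIntegral.integral_div, intervalIntegral.integral_add i1 i2,
    integral_mlKernel_mul_mlKernel hd (by positivity) h2 h1 hs, Ufun_eq_mlKernel,
    Ufun_eq_mlKernel]
  field_simp
  ring

theorem tendsto_CovY {s : ℝ} (ha2 : 0 < a2) (ha12 : a2 < a1) (ha1 : a1 < 1)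
    (hC1 : 0 < C1) (hC2 : 0 < C2) (hs : 0 < s) :
    Tendsto (fun t => CovY a1 a2 C1 C2 s t) atTop
      (𝓝 (s ^ (2 * a1) / C1 ^ 2
        * ML2 (a1 - a2) (2 * a1 + 1) (-C2 * s ^ (a1 - a2) / C1))) := by
  have h := ((tendsto_integral_mlKernel_sub (c := C2 / C1) (sub_pos.2 ha12)
    (by linarith) (by positivity) (show a1 - a2 ≤ a1 by linarith) ha1 hs).const_add
    (mlKernel2 (a1 - a2) (C2 / C1) (1 + a1 + a1) s)).div_const (C1 ^ 2)
  have e : s ^ (2 * a1) / C1 ^ 2 * ML2 (a1 - a2) (2 * a1 + 1) (-C2 * s ^ (a1 - a2) / C1)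
      = (mlKernel2 (a1 - a2) (C2 / C1) (1 + a1 + a1) s + 0) / C1 ^ 2 := by
    rw [mlKernel2, show 1 + a1 + a1 = 2 * a1 + 1 by ring, add_sub_cancel_right,
      show -C2 * s ^ (a1 - a2) / C1 = -(C2 / C1 * s ^ (a1 - a2)) by ring]
    ring
  rw [e]
  refine h.congr' ?_
  filter_upwards [eventually_ge_atTop s] with t ht
  rw [CovY_eq_mlKernel ha2 ha12 hC1 hC2 hs ht]

theorem tendsto_rpow_mul_Ufun (ha2 : 0 < a2) (ha12 : a2 < a1) (ha1 : a1 < 1)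
    (hC1 : 0 < C1) (hC2 : 0 < C2) :
    Tendsto (fun t => t ^ (-a2) * Ufun a1 a2 C1 C2 t) atTop
      (𝓝 (1 / (C2 * Real.Gamma (a2 + 1)))) := by
  have h := (tendsto_rpow_mul_mlKernel (c := C2 / C1) (b := a2 + 1) (sub_pos.2 ha12)
    (by linarith) (by positivity) (by linarith)).div_const C2
  rw [div_div, mul_comm (Real.Gamma _)] at h
  refine h.congr fun t => ?_
  rw [Ufun_eq_mlKernel, show a2 + 1 + (a1 - a2) = 1 + a1 by ring,
    show 1 - (a2 + 1) = -a2 by ring]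
  field_simp

theorem tendsto_rpow_mul_VarY (ha2 : 0 < a2) (ha12 : a2 < a1) (ha1 : a1 < 1)
    (hC1 : 0 < C1) (hC2 : 0 < C2) :
    Tendsto (fun t => t ^ (-(2 * a2)) * VarY a1 a2 C1 C2 t) atTop
      (𝓝 (1 / C2 ^ 2 * (2 / Real.Gamma (2 * a2 + 1) - 1 / Real.Gamma (a2 + 1) ^ 2))) := by
  have hd : 0 < a1 - a2 := by linarith
  have h1 := (tendsto_rpow_mul_mlKernel2 (c := C2 / C1) (b := a2 + 1) (q := a1) hd
    (by linarith) (by positivity) (by linarith) (by linarith)).const_mul (2 / C2 ^ 2)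
  have h2 := h1.sub ((tendsto_rpow_mul_Ufun ha2 ha12 ha1 hC1 hC2).pow 2)
  rw [show a2 + 1 + a1 - (a1 - a2) = 2 * a2 + 1 by ring,
    show 1 - (2 * a2 + 1) = -(2 * a2) by ring,
    show a2 + 1 + (a1 - a2) + a1 = 1 + a1 + a1 by ring] at h2
  have e : 1 / C2 ^ 2 * (2 / Real.Gamma (2 * a2 + 1) - 1 / Real.Gamma (a2 + 1) ^ 2)
      = 2 / C2 ^ 2 * (1 / Real.Gamma (2 * a2 + 1))
        - (1 / (C2 * Real.Gamma (a2 + 1))) ^ 2 := by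
    rw [div_pow, mul_pow]; ring
  rw [e]
  refine h2.congr' ?_
  filter_upwards [eventually_gt_atTop 0] with t ht
  have e2 : (t ^ (-a2)) ^ 2 = t ^ (-(2 * a2)) := by
    rw [← rpow_natCast, ← rpow_mul ht.le]; congr 1; push_cast; ring
  rw [VarY, CovY_eq_mlKernel ha2 ha12 hC1 hC2 ht le_rfl,
    integral_mlKernel_mul_mlKernel hd (by positivity) (by linarith) (by linarith) ht,
    mul_pow, e2, Ufun_eq_mlKernel]
  field_simp
  ring

theorem tendsto_rpow_mul_VarN (ha2 : 0 < a2) (ha12 : a2 < a1) (ha1 : a1 < 1)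
    (hC1 : 0 < C1) (hC2 : 0 < C2) (lam : ℝ) :
    Tendsto (fun t => t ^ (-(2 * a2)) * VarN a1 a2 C1 C2 lam t) atTop
      (𝓝 (lam ^ 2 / C2 ^ 2
        * (2 / Real.Gamma (2 * a2 + 1) - 1 / Real.Gamma (a2 + 1) ^ 2))) := by
  have h1 := ((tendsto_rpow_neg_atTop ha2).mul
    (tendsto_rpow_mul_Ufun ha2 ha12 ha1 hC1 hC2)).const_mul lam
  have h2 := h1.add ((tendsto_rpow_mul_VarY ha2 ha12 ha1 hC1 hC2).const_mul (lam ^ 2))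
  rw [zero_mul, mul_zero, zero_add, ← mul_assoc, mul_one_div] at h2
  refine h2.congr' ?_
  filter_upwards [eventually_gt_atTop 0] with t ht
  rw [VarN, show -(2 * a2) = -a2 + -a2 by ring, rpow_add ht]
  ring

end Renewal


/-- Theorem 3.5 (LRD of the MFPP): for fixed `λ > 0`, `s > 0` with `Var_N(s) > 0`,
`t^{α₂} Corr_N(s,t)` converges to the stated constant as `t → ∞`. -/
theorem stmt_9 (a1 a2 C1 C2 : ℝ) (ha2 : 0 < a2) (ha12 : a2 < a1) (ha1 : a1 < 1)
    (hC1 : 0 < C1) (hC2 : 0 < C2) (hC : C1 + C2 = 1) (lam : ℝ) (hlam : 0 < lam)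
    (s : ℝ) (hs : 0 < s) (hv : 0 < VarN a1 a2 C1 C2 lam s) :
    Tendsto (fun t : ℝ => t ^ a2 * CorrN a1 a2 C1 C2 lam s t) atTop
      (𝓝 ((lam * Ufun a1 a2 C1 C2 s
            + lam ^ 2 * s ^ (2 * a1) / C1 ^ 2
              * ML2 (a1 - a2) (2 * a1 + 1) (-C2 * s ^ (a1 - a2) / C1))
        / (Real.sqrt (VarN a1 a2 C1 C2 lam s)
            * Real.sqrt (lam ^ 2 / C2 ^ 2
              * (2 / Real.Gamma (2 * a2 + 1) - 1 / Real.Gamma (a2 + 1) ^ 2))))) := by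
  set L := lam ^ 2 / C2 ^ 2
    * (2 / Real.Gamma (2 * a2 + 1) - 1 / Real.Gamma (a2 + 1) ^ 2) with hL
  have hLpos : 0 < L := by
    have hG1 := Real.Gamma_pos_of_pos (show 0 < a2 + 1 by linarith)
    have hG2 := Real.Gamma_pos_of_pos (show 0 < 2 * a2 + 1 by linarith)
    have h := Gamma_two_mul_add_one_lt ha2 (ha12.trans ha1)
    refine mul_pos (by positivity) (sub_pos.2 ?_)
    rw [div_lt_div_iff₀ (by positivity) hG2]
    linarith
  have hVar := (tendsto_rpow_mul_VarN ha2 ha12 ha1 hC1 hC2 lam).sqrt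
  rw [← hL] at hVar
  have hCov := ((tendsto_CovY ha2 ha12 ha1 hC1 hC2 hs).const_mul (lam ^ 2)).const_add
    (lam * Ufun a1 a2 C1 C2 s)
  rw [← mul_assoc, ← mul_div_assoc] at hCov
  have hne : Real.sqrt (VarN a1 a2 C1 C2 lam s) * Real.sqrt L ≠ 0 :=
    (mul_pos (Real.sqrt_pos.2 hv) (Real.sqrt_pos.2 hLpos)).ne'
  refine (hCov.div (hVar.const_mul _) hne).congr' ?_
  filter_upwards [eventually_ge_atTop s] with t ht
  have ht0 : 0 < t := hs.trans_le ht
  have ht2 : t ^ (-(2 * a2)) = (t ^ (-a2)) ^ 2 := by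
    rw [← rpow_natCast, ← rpow_mul ht0.le]; congr 1; push_cast; ring
  rw [Pi.div_apply, CorrN, CovN, min_eq_left ht, ht2, Real.sqrt_mul (by positivity),
    Real.sqrt_sq (by positivity), rpow_neg ht0.le]
  simp only [div_eq_mul_inv, mul_inv, inv_inv]
  ring
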